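/- Let k ≥ 1 be an integer. For every complex number w with 0 < Re w < 1 and every real t > 0, one has φ_{w,k}(t) = (d/dw)^k [ U(w)·t^{−w} ] + 2·(−1)^k·k!·Σ_{j≥1} (−1)^j · (2πt)^{2j}/(2j+1)! · 2j/(w+2j)^{k+1}, where (d/dw)^k denotes the k-th derivative in w of the function w ↦ U(w)·t^{−w} and the series converges absolutely. Consequently there is a constant C such that |φ_{w,k}(t) − (d/dw)^k[U(w)·t^{−w}]| ≤ C for all w with 0 < Re w < 1 and all 0 < t ≤ 1. -/

import Mathlib

open MeasureTheory Set Filter intervalIntegral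

/-- The Báez-Duarte spectral function
`U(w) = (w/(1-w))·2^{1-w}·π^{-w}·cos(πw/2)·Γ(w)`. -/
noncomputable def baezDuarteU (w : ℂ) : ℂ :=
  (w / (1 - w)) * (2 : ℂ) ^ (1 - w) * (Real.pi : ℂ) ^ (-w)
    * Complex.cos ((Real.pi : ℂ) * w / 2) * Complex.Gamma w

open Topology in
theorem iteratedDeriv_eq_of_hasDerivAt_succ {S : Set ℂ} (hS : IsOpen S) (F : ℕ → ℂ → ℂ)
    (hF : ∀ n, ∀ z ∈ S, HasDerivAt (F n) (F (n + 1) z) z) (n : ℕ) :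
    ∀ z ∈ S, iteratedDeriv n (F 0) z = F n z := by
  induction n with
  | zero => simp
  | succ n ih =>
    intro z hz
    rw [iteratedDeriv_succ]
    have : iteratedDeriv n (F 0) =ᶠ[𝓝 z] F n := by
      filter_upwards [hS.mem_nhds hz] with y hy using ih y hy
    rw [this.deriv_eq, (hF n z hz).deriv]

open Asymptotics Topology in
theorem isBigO_sin_nhdsGT_zero :
    (fun x : ℝ => (Real.sin x : ℂ)) =O[𝓝[>] 0] (fun x : ℝ => x ^ (-(-1 : ℝ))) := by
  refine IsBigO.of_bound 1 (Eventually.of_forall fun x => ?_)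
  rw [Complex.norm_real, one_mul, neg_neg, Real.rpow_one]
  exact Real.abs_sin_le_abs

theorem mellinConvergent_sin {s : ℂ} (h1 : -1 < s.re) (h0 : s.re < 0) :
    MellinConvergent (fun x : ℝ => (Real.sin x : ℂ)) s := by
  refine mellinConvergent_of_isBigO_rpow (a := 0) (b := -1) ?_ ?_ h0 isBigO_sin_nhdsGT_zero h1
  · exact (by fun_prop : Continuous fun x : ℝ => (Real.sin x : ℂ)).locallyIntegrable
        |>.locallyIntegrableOn _
  · refine Asymptotics.IsBigO.of_bound 1 (Eventually.of_forall fun x => ?_)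
    rw [Complex.norm_real]
    simpa using Real.abs_sin_le_one x

theorem Complex.exp_mul_sin_eq (ε x : ℝ) :
    ((Real.exp (-ε * x) * Real.sin x : ℝ) : ℂ) =
      (Complex.exp (-((ε - Complex.I) * x)) - Complex.exp (-((ε + Complex.I) * x)))
        / (2 * Complex.I) := by
  have h : Complex.sin x =
      (Complex.exp (x * Complex.I) - Complex.exp (-x * Complex.I)) / (2 * Complex.I) := by
    rw [Complex.sin]
    field_simp
    rw [Complex.I_sq]; ring
  push_cast
  rw [h, mul_div_assoc', mul_sub, ← Complex.exp_add, ← Complex.exp_add]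
  ring_nf

theorem mellinConvergent_cexp_neg_mul {r s : ℂ} (hr : 0 < r.re) (hs : 0 < s.re) :
    MellinConvergent (fun t : ℝ => Complex.exp (-(r * t))) s := by
  refine mellinConvergent_of_isBigO_rpow_exp (a := r.re) (b := 0) hr ?_ ?_ ?_ hs
  · exact (by fun_prop : Continuous fun t : ℝ => Complex.exp (-(r * t))).locallyIntegrable
        |>.locallyIntegrableOn _
  · refine Asymptotics.IsBigO.of_bound 1 (Eventually.of_forall fun x => ?_)
    simp [Complex.norm_exp]
  · refine Asymptotics.IsBigO.of_bound 1 (eventually_mem_nhdsWithin.mono fun x hx => ?_)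
    have hx' : (0 : ℝ) < x := hx
    simp [Complex.norm_exp]
    positivity

open Topology in
theorem differentiableAt_mellin_cexp_neg_mul {r s : ℂ} (hr : 0 < r.re) (hs : 0 < s.re) :
    DifferentiableAt ℂ (fun r : ℂ => mellin (fun t : ℝ => Complex.exp (-(r * t))) s) r := by
  have hmeas : ∀ r : ℂ, AEStronglyMeasurable
      (fun t : ℝ => (t : ℂ) ^ (s - 1) • Complex.exp (-(r * t))) (volume.restrict (Ioi 0)) := fun r =>
    ContinuousOn.aestronglyMeasurable (ContinuousOn.fun_smul (fun x hx =>
      (Complex.continuousAt_ofReal_cpow_const _ _ (Or.inr (ne_of_gt hx))).continuousWithinAt)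
      (by fun_prop)) measurableSet_Ioi
  have hopen : IsOpen {z : ℂ | r.re / 2 < z.re} := isOpen_lt continuous_const Complex.continuous_re
  have hb : MellinConvergent (fun t : ℝ => Complex.exp (-(((r.re / 2 : ℝ) : ℂ) * t))) (s + 1) :=
    mellinConvergent_cexp_neg_mul (by simpa using hr) (by simp; linarith)
  refine (hasDerivAt_integral_of_dominated_loc_of_deriv_le
    (F' := fun (r : ℂ) (t : ℝ) => (t : ℂ) ^ (s - 1) • (Complex.exp (-(r * t)) * (-t)))
    (hopen.mem_nhds (by simp [hr] : r.re / 2 < r.re)) (Eventually.of_forall hmeas)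
    (mellinConvergent_cexp_neg_mul hr hs) ?_ ?_ hb.norm ?_).2.differentiableAt
  · have := (hmeas r).mul (by fun_prop : Continuous fun t : ℝ => (-t : ℂ)).aestronglyMeasurable
    refine this.congr (Eventually.of_forall fun t => ?_)
    simp [mul_assoc]
  · refine (ae_restrict_iff' measurableSet_Ioi).2 (Eventually.of_forall fun t ht z hz => ?_)
    have ht' : (0 : ℝ) < t := ht
    have hz' : r.re / 2 < z.re := hz
    rw [add_sub_cancel_right, norm_smul, norm_smul, norm_mul, Complex.norm_exp, Complex.norm_exp,
      mul_comm (Real.exp _), ← mul_assoc, norm_neg]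
    have : ‖(t : ℂ) ^ (s - 1)‖ * ‖(t : ℂ)‖ = ‖(t : ℂ) ^ s‖ := by
      rw [← norm_mul, Complex.cpow_sub _ _ (Complex.ofReal_ne_zero.2 ht'.ne'), Complex.cpow_one,
        div_mul_cancel₀ _ (Complex.ofReal_ne_zero.2 ht'.ne')]
    rw [this]
    refine mul_le_mul_of_nonneg_left (Real.exp_le_exp.2 ?_) (norm_nonneg _)
    rw [Complex.neg_re, Complex.neg_re, Complex.re_mul_ofReal, Complex.re_mul_ofReal,
      Complex.ofReal_re]
    exact neg_le_neg (mul_le_mul_of_nonneg_right hz'.le ht'.le)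
  · refine Eventually.of_forall fun t z hz => ?_
    refine HasDerivAt.fun_const_smul _ ?_
    have : HasDerivAt (fun z : ℂ => -(z * t)) (-t) z := by
      simpa using ((hasDerivAt_id z).mul_const (t : ℂ)).fun_neg
    exact this.cexp

open Topology in
theorem mellin_cexp_neg_mul {r s : ℂ} (hr : 0 < r.re) (hs : 0 < s.re) :
    mellin (fun t : ℝ => Complex.exp (-(r * t))) s = (1 / r) ^ s * Complex.Gamma s := by
  have hopen : IsOpen {z : ℂ | 0 < z.re} := isOpen_lt continuous_const Complex.continuous_re
  have key : EqOn (fun r : ℂ => mellin (fun t : ℝ => Complex.exp (-(r * t))) s)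
      (fun r => (1 / r) ^ s * Complex.Gamma s) {z : ℂ | 0 < z.re} := by
    refine AnalyticOnNhd.eqOn_of_preconnected_of_frequently_eq (z₀ := 1)
      (DifferentiableOn.analyticOnNhd (fun z hz =>
        (differentiableAt_mellin_cexp_neg_mul hz hs).differentiableWithinAt) hopen)
      (DifferentiableOn.analyticOnNhd (fun z hz => ?_) hopen)
      (convex_halfSpace_re_gt _).isPreconnected (by simp) ?_
    · have hz' : 0 < z.re := hz
      have hz0 : z ≠ 0 := by rintro rfl; simp at hz'
      have hs : 1 / z ∈ Complex.slitPlane := by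
        refine Complex.mem_slitPlane_iff.2 (Or.inl ?_)
        rw [one_div, Complex.inv_re]
        exact div_pos hz' (Complex.normSq_pos.2 hz0)
      have h1 : DifferentiableAt ℂ (fun z : ℂ => 1 / z) z :=
        (differentiableAt_const _).fun_div differentiableAt_id hz0
      exact ((h1.cpow (differentiableAt_const s) hs).mul_const _).differentiableWithinAt
    · have hT : Tendsto (fun x : ℝ => (x : ℂ)) (𝓝[≠] 1) (𝓝[≠] 1) := by
        refine tendsto_nhdsWithin_iff.2 ⟨?_, ?_⟩
        · simpa using (Complex.continuous_ofReal.tendsto 1).mono_left nhdsWithin_le_nhds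
        · filter_upwards [self_mem_nhdsWithin] with x hx
          simpa using hx
      refine hT.frequently (Eventually.frequently ?_)
      filter_upwards [mem_nhdsWithin_of_mem_nhds (lt_mem_nhds (zero_lt_one' ℝ))] with x hx
      exact Complex.integral_cpow_mul_exp_neg_mul_Ioi hs hx
  exact key hr

theorem mellin_exp_mul_sin_of_re_pos {ε : ℝ} (hε : 0 < ε) {s : ℂ} (hs : 0 < s.re) :
    mellin (fun x : ℝ => ((Real.exp (-ε * x) * Real.sin x : ℝ) : ℂ)) s =
      Complex.Gamma s * ((1 / (ε - Complex.I)) ^ s - (1 / (ε + Complex.I)) ^ s)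
        / (2 * Complex.I) := by
  have h1 : 0 < ((ε : ℂ) - Complex.I).re := by simpa
  have h2 : 0 < ((ε : ℂ) + Complex.I).re := by simpa
  simp only [Complex.exp_mul_sin_eq]
  rw [mellin_div_const, (hasMellin_sub (mellinConvergent_cexp_neg_mul h1 hs)
    (mellinConvergent_cexp_neg_mul h2 hs)).2, mellin_cexp_neg_mul h1 hs, mellin_cexp_neg_mul h2 hs]
  ring

open Topology in
theorem mellin_exp_mul_sin {ε : ℝ} (hε : 0 < ε) {s : ℂ} (h1 : -1 < s.re) (h0 : s ≠ 0) :
    mellin (fun x : ℝ => ((Real.exp (-ε * x) * Real.sin x : ℝ) : ℂ)) s =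
      Complex.Gamma s * ((1 / (ε - Complex.I)) ^ s - (1 / (ε + Complex.I)) ^ s)
        / (2 * Complex.I) := by
  have hopen : IsOpen {z : ℂ | -1 < z.re} := isOpen_lt continuous_const Complex.continuous_re
  have hne1 : (ε : ℂ) - Complex.I ≠ 0 := fun h => by simpa [hε.ne'] using congrArg Complex.re h
  have hne2 : (ε : ℂ) + Complex.I ≠ 0 := fun h => by simpa [hε.ne'] using congrArg Complex.re h
  have key : EqOn (fun z => z * mellin (fun x : ℝ => ((Real.exp (-ε * x) * Real.sin x : ℝ) : ℂ)) z)
      (fun z => Complex.Gamma (z + 1) * ((1 / (ε - Complex.I)) ^ z - (1 / (ε + Complex.I)) ^ z)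
        / (2 * Complex.I)) {z : ℂ | -1 < z.re} := by
    refine AnalyticOnNhd.eqOn_of_preconnected_of_eventuallyEq (z₀ := 1)
      (DifferentiableOn.analyticOnNhd (fun z hz => ?_) hopen)
      (DifferentiableOn.analyticOnNhd (fun z hz => ?_) hopen)
      (convex_halfSpace_re_gt _).isPreconnected (by simp) ?_
    · refine (differentiableAt_id.mul ?_).differentiableWithinAt
      refine mellin_differentiableAt_of_isBigO_rpow_exp (a := ε) (b := -1) hε ?_ ?_ ?_ hz
      · exact (by fun_prop : Continuous fun x : ℝ => ((Real.exp (-ε * x) * Real.sin x : ℝ) : ℂ)).locallyIntegrable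
        |>.locallyIntegrableOn _
      · refine Asymptotics.IsBigO.of_bound 1 (Eventually.of_forall fun x => ?_)
        rw [Complex.norm_real, norm_mul, one_mul]
        exact mul_le_of_le_one_right (norm_nonneg _) (Real.abs_sin_le_one x)
      · refine Asymptotics.IsBigO.of_bound 1 (eventually_mem_nhdsWithin.mono fun x hx => ?_)
        have hx' : (0 : ℝ) < x := hx
        rw [Complex.norm_real, norm_mul, one_mul, neg_neg, Real.rpow_one]
        have : ‖Real.exp (-ε * x)‖ ≤ 1 := by
          rw [Real.norm_eq_abs, Real.abs_exp]
          exact Real.exp_le_one_iff.2 (by nlinarith)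
        exact (mul_le_of_le_one_left (norm_nonneg _) this).trans Real.abs_sin_le_abs
    · have hG : DifferentiableAt ℂ (fun z => Complex.Gamma (z + 1)) z := by
        refine DifferentiableAt.comp (g := Complex.Gamma) z
          (Complex.differentiableAt_Gamma _ fun m hm => ?_) (by fun_prop)
        have hz' : -1 < z.re := hz
        have := congrArg Complex.re hm
        simp at this
        have : (0 : ℝ) ≤ m := by positivity
        linarith
      refine DifferentiableAt.differentiableWithinAt ?_
      have e1 : DifferentiableAt ℂ (fun z : ℂ => (1 / ((ε : ℂ) - Complex.I)) ^ z) z :=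
        differentiableAt_id.const_cpow (Or.inl (one_div_ne_zero hne1))
      have e2 : DifferentiableAt ℂ (fun z : ℂ => (1 / ((ε : ℂ) + Complex.I)) ^ z) z :=
        differentiableAt_id.const_cpow (Or.inl (one_div_ne_zero hne2))
      exact (hG.mul (e1.sub e2)).div_const _
    · have : {z : ℂ | 0 < z.re} ∈ 𝓝 (1 : ℂ) :=
        (isOpen_lt continuous_const Complex.continuous_re).mem_nhds (by simp)
      filter_upwards [this] with z hz
      have hz0 : z ≠ 0 := by rintro rfl; simp at hz
      rw [mellin_exp_mul_sin_of_re_pos hε hz, Complex.Gamma_add_one z hz0]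
      ring
  have := key h1
  simp only [Complex.Gamma_add_one s h0] at this
  apply mul_left_cancel₀ h0
  rw [this]; ring

open Topology in
theorem mellin_sin {s : ℂ} (h1 : -1 < s.re) (h0 : s.re < 0) :
    mellin (fun x : ℝ => (Real.sin x : ℂ)) s = Complex.Gamma s * Complex.sin (Real.pi * s / 2) := by
  have hs0 : s ≠ 0 := by rintro rfl; simp at h0
  have L1 : Tendsto (fun ε : ℝ =>
        mellin (fun x : ℝ => ((Real.exp (-ε * x) * Real.sin x : ℝ) : ℂ)) s)
      (𝓝[>] 0) (𝓝 (mellin (fun x : ℝ => (Real.sin x : ℂ)) s)) := by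
    refine tendsto_integral_filter_of_dominated_convergence
      (fun x : ℝ => ‖(x : ℂ) ^ (s - 1) • (Real.sin x : ℂ)‖) ?_ ?_
      (mellinConvergent_sin h1 h0).norm ?_
    · refine Eventually.of_forall fun ε => ?_
      refine ContinuousOn.aestronglyMeasurable (ContinuousOn.fun_smul ?_ ?_) measurableSet_Ioi
      · exact fun x hx =>
          (Complex.continuousAt_ofReal_cpow_const _ _ (Or.inr (ne_of_gt hx))).continuousWithinAt
      · fun_prop
    · filter_upwards [self_mem_nhdsWithin] with ε hε
      refine (ae_restrict_iff' measurableSet_Ioi).2 (Eventually.of_forall fun x hx => ?_)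
      have hε' : (0 : ℝ) < ε := hε
      have hx' : (0 : ℝ) < x := hx
      rw [norm_smul, norm_smul]
      gcongr
      rw [Complex.norm_real, Complex.norm_real, norm_mul, Real.norm_eq_abs, Real.abs_exp]
      exact mul_le_of_le_one_left (norm_nonneg _) (Real.exp_le_one_iff.2 (by nlinarith))
    · refine Eventually.of_forall fun x => ?_
      refine Tendsto.const_smul ?_ _
      have : Continuous fun ε : ℝ => ((Real.exp (-ε * x) * Real.sin x : ℝ) : ℂ) := by fun_prop
      simpa using (this.tendsto 0).mono_left nhdsWithin_le_nhds
  have L2 : Tendsto (fun ε : ℝ =>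
        Complex.Gamma s * ((1 / (ε - Complex.I)) ^ s - (1 / (ε + Complex.I)) ^ s)
        / (2 * Complex.I)) (𝓝[>] 0) (𝓝 (Complex.Gamma s * (Complex.I ^ s - (-Complex.I) ^ s)
        / (2 * Complex.I))) := by
    have c1 : ContinuousAt (fun ε : ℝ => (1 / ((ε : ℂ) - Complex.I)) ^ s) 0 := by
      refine ContinuousAt.cpow (ContinuousAt.div (by fun_prop) (by fun_prop) (by simp))
        (by fun_prop) ?_
      simp [Complex.mem_slitPlane_iff]
    have c2 : ContinuousAt (fun ε : ℝ => (1 / ((ε : ℂ) + Complex.I)) ^ s) 0 := by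
      refine ContinuousAt.cpow (ContinuousAt.div (by fun_prop) (by fun_prop) (by simp))
        (by fun_prop) ?_
      simp [Complex.mem_slitPlane_iff]
    have := ((c1.sub c2).const_mul (Complex.Gamma s)).div_const (2 * Complex.I)
    have := this.tendsto.mono_left (nhdsWithin_le_nhds (s := Ioi 0))
    simpa using this
  have L1' := L1.congr' (f₂ := fun ε : ℝ =>
        Complex.Gamma s * ((1 / (ε - Complex.I)) ^ s - (1 / (ε + Complex.I)) ^ s)
        / (2 * Complex.I)) (by
    filter_upwards [self_mem_nhdsWithin] with ε hε using mellin_exp_mul_sin hε h1 hs0)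
  rw [tendsto_nhds_unique L1' L2, Complex.cpow_def_of_ne_zero Complex.I_ne_zero,
    Complex.cpow_def_of_ne_zero (neg_ne_zero.2 Complex.I_ne_zero), Complex.log_I, Complex.log_neg_I,
    Complex.sin]
  field_simp
  rw [Complex.I_sq]
  ring_nf

theorem hasMellin_sin_div {t : ℝ} (ht : 0 < t) {w : ℂ} (h0 : 0 < w.re) (h1 : w.re < 1) :
    HasMellin (fun u : ℝ => ((Real.sin (2 * Real.pi * t * u) / (Real.pi * t * u) : ℝ) : ℂ)) w
      (((2 * Real.pi * t : ℝ) : ℂ) ^ (1 - w) * (Complex.Gamma (w - 1) *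
        Complex.sin (Real.pi * (w - 1) / 2)) / (Real.pi * t)) := by
  have ha : 0 < 2 * Real.pi * t := by positivity
  have hs1 : -1 < (w - 1).re := by simp [h0]
  have hs0 : (w - 1).re < 0 := by simp [h1]
  have hcongr : ∀ u ∈ Ioi (0 : ℝ), (u : ℂ) ^ (w - 1) •
      ((Real.sin (2 * Real.pi * t * u) / (Real.pi * t * u) : ℝ) : ℂ) =
      (u : ℂ) ^ (w - 1) • (((u : ℂ) ^ (-1 : ℂ) • (Real.sin (2 * Real.pi * t * u) : ℂ)) /
        (Real.pi * t)) := by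
    intro u hu
    rw [Complex.cpow_neg_one]
    push_cast
    simp only [smul_eq_mul]
    field_simp
  have hc : MellinConvergent (fun u : ℝ => (u : ℂ) ^ (-1 : ℂ) •
      (Real.sin (2 * Real.pi * t * u) : ℂ)) w :=
    MellinConvergent.cpow_smul.2 <|
      (MellinConvergent.comp_mul_left (f := fun x : ℝ => (Real.sin x : ℂ)) ha).2 <|
        mellinConvergent_sin hs1 hs0
  refine ⟨(integrableOn_congr_fun hcongr measurableSet_Ioi).2 (hc.div_const _), ?_⟩
  rw [mellin, setIntegral_congr_fun measurableSet_Ioi hcongr, ← mellin, mellin_div_const,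
    mellin_cpow_smul, mellin_comp_mul_left (fun x : ℝ => (Real.sin x : ℂ)) _ ha,
    ← sub_eq_add_neg, mellin_sin hs1 hs0, neg_sub, smul_eq_mul]

theorem baezDuarteU_mul_cpow_eq {t : ℝ} (ht : 0 < t) {w : ℂ} (h1 : w.re < 1) :
    baezDuarteU w * (t : ℂ) ^ (-w) = w * (((2 * Real.pi * t : ℝ) : ℂ) ^ (1 - w) *
      (Complex.Gamma (w - 1) * Complex.sin (Real.pi * (w - 1) / 2)) / (Real.pi * t)) := by
  have hw : w - 1 ≠ 0 := fun h => by
    have := congrArg Complex.re h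
    simp at this
    linarith
  have hw' : 1 - w ≠ 0 := fun h => hw (by rw [← neg_sub, h, neg_zero])
  have hG : Complex.Gamma w = (w - 1) * Complex.Gamma (w - 1) := by
    simpa using Complex.Gamma_add_one (w - 1) hw
  have hsin : Complex.sin (Real.pi * (w - 1) / 2) = -Complex.cos (Real.pi * w / 2) := by
    rw [← Complex.sin_sub_pi_div_two]; ring_nf
  have hpi : (Real.pi : ℂ) ≠ 0 := Complex.ofReal_ne_zero.2 Real.pi_ne_zero
  have ht0 : (t : ℂ) ≠ 0 := Complex.ofReal_ne_zero.2 ht.ne'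
  have hpow : ((2 * Real.pi * t : ℝ) : ℂ) ^ (1 - w) =
      2 ^ (1 - w) * (Real.pi * (Real.pi : ℂ) ^ (-w)) * (t * (t : ℂ) ^ (-w)) := by
    rw [Complex.ofReal_mul, Complex.mul_cpow_ofReal_nonneg (by positivity) ht.le, Complex.ofReal_mul,
      Complex.mul_cpow_ofReal_nonneg (by positivity) Real.pi_pos.le, sub_eq_add_neg,
      Complex.cpow_add _ _ hpi, Complex.cpow_add _ _ ht0, Complex.cpow_one, Complex.cpow_one]
    norm_num
  rw [baezDuarteU, hG, hsin, hpow]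
  field_simp
  ring

theorem hasSum_mellin_indicator_sin_div {t : ℝ} (ht : 0 < t) {w : ℂ} (h0 : 0 < w.re) :
    HasSum (fun j : ℕ => 2 * ((-1 : ℂ) ^ j * (((2 * Real.pi * t) ^ (2 * j) : ℝ) : ℂ) /
        (Nat.factorial (2 * j + 1) : ℂ)) / (w + (2 * j : ℕ)))
      (mellin (indicator (Ioc 0 1) fun u : ℝ =>
        ((Real.sin (2 * Real.pi * t * u) / (Real.pi * t * u) : ℝ) : ℂ)) w) := by
  set c : ℕ → ℂ := fun j => 2 * ((-1 : ℂ) ^ j * (((2 * Real.pi * t) ^ (2 * j) : ℝ) : ℂ) /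
        (Nat.factorial (2 * j + 1) : ℂ)) with hc
  have hsum : Summable fun j => ‖c j‖ := by
    have h := (Real.summable_pow_div_factorial (2 * Real.pi * t)).comp_injective
      (i := fun j : ℕ => 2 * j) (fun a b h => by simpa using h)
    refine Summable.of_nonneg_of_le (fun _ => norm_nonneg _) (fun j => ?_) (h.mul_left 2)
    simp only [hc, norm_mul, norm_div, norm_pow, norm_neg, norm_one, one_pow, one_mul,
      Complex.norm_real, Complex.norm_natCast, Complex.norm_ofNat, Function.comp]
    rw [Real.norm_ofNat, Real.norm_of_nonneg Real.pi_pos.le, Real.norm_of_nonneg ht.le]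
    gcongr
    omega
  have hterm : ∀ j : ℕ, HasMellin (fun u : ℝ => c j • indicator (Ioc 0 1)
      (fun u : ℝ => (u : ℂ) ^ ((2 * j : ℕ) : ℂ)) u) w (c j • (1 / (w + (2 * j : ℕ)))) := by
    intro j
    have h := hasMellin_cpow_Ioc ((2 * j : ℕ) : ℂ) (s := w)
      (by rw [Complex.natCast_re]; positivity)
    have := hasMellin_const_smul h.1 (c j)
    rwa [h.2] at this
  have hone := (hasMellin_one_Ioc h0).1
  have key := MeasureTheory.hasSum_integral_of_dominated_convergence
    (μ := volume.restrict (Ioi 0))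
    (F := fun (j : ℕ) (u : ℝ) => (u : ℂ) ^ (w - 1) • (c j • indicator (Ioc 0 1)
      (fun u : ℝ => (u : ℂ) ^ ((2 * j : ℕ) : ℂ)) u))
    (f := fun u : ℝ => (u : ℂ) ^ (w - 1) • (indicator (Ioc 0 1) (fun u : ℝ =>
        ((Real.sin (2 * Real.pi * t * u) / (Real.pi * t * u) : ℝ) : ℂ)) u))
    (fun j u => ‖c j‖ * ‖(u : ℂ) ^ (w - 1) • indicator (Ioc (0 : ℝ) 1) (fun _ => (1 : ℂ)) u‖)
    (fun j => (hterm j).1.aestronglyMeasurable) (fun j => ?_) ?_ ?_ ?_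
  · have e : ∀ j, ∫ u : ℝ in Ioi 0, (u : ℂ) ^ (w - 1) • (c j • indicator (Ioc 0 1)
      (fun u : ℝ => (u : ℂ) ^ ((2 * j : ℕ) : ℂ)) u) = c j / (w + (2 * j : ℕ)) := fun j => by
      have := (hterm j).2
      rw [mellin, smul_eq_mul, mul_one_div] at this
      exact this
    simp only [e] at key
    exact key
  · refine Eventually.of_forall fun u => ?_
    by_cases hu : u ∈ Ioc (0 : ℝ) 1
    · simp only [indicator_of_mem hu, norm_smul, norm_one, mul_one]
      rw [mul_left_comm]
      refine mul_le_mul_of_nonneg_left (mul_le_of_le_one_right (norm_nonneg _) ?_) (norm_nonneg _)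
      rw [Complex.cpow_natCast, norm_pow, Complex.norm_real, Real.norm_of_nonneg hu.1.le]
      exact pow_le_one₀ hu.1.le hu.2
    · simp [indicator_of_notMem hu]
  · exact Eventually.of_forall fun u => hsum.mul_right _
  · simp only [tsum_mul_right]
    exact hone.norm.const_mul _
  · refine (ae_restrict_iff' measurableSet_Ioi).2 (Eventually.of_forall fun u hu' => ?_)
    refine HasSum.const_smul _ ?_
    by_cases hu : u ∈ Ioc (0 : ℝ) 1
    · simp only [indicator_of_mem hu]
      have h := (Complex.hasSum_sin (2 * Real.pi * t * u)).div_const (Real.pi * t * u)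
      rw [Complex.ofReal_div, Complex.ofReal_sin]
      push_cast
      refine h.congr_fun fun j => ?_
      have : (u : ℂ) ≠ 0 := Complex.ofReal_ne_zero.2 hu.1.ne'
      have ht0 : (t : ℂ) ≠ 0 := Complex.ofReal_ne_zero.2 ht.ne'
      have hpi : (Real.pi : ℂ) ≠ 0 := Complex.ofReal_ne_zero.2 Real.pi_ne_zero
      rw [← Nat.cast_ofNat, ← Nat.cast_mul, Complex.cpow_natCast, smul_eq_mul, hc]
      push_cast
      rw [pow_succ _ (2 * j), mul_pow _ (u : ℂ)]
      field_simp
    · simp only [indicator_of_notMem hu, smul_zero]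
      exact hasSum_zero

/-- The function `(-log v)^n · v·sin(2πt/v)/(πt)`, cut off to `(0,1)`. -/
noncomputable def truncLogSin (t : ℝ) (n : ℕ) : ℝ → ℂ :=
  indicator (Ioo 0 1) fun v : ℝ =>
    (((-Real.log v) ^ n * (v * Real.sin (2 * Real.pi * t / v) / (Real.pi * t)) : ℝ) : ℂ)

/-- The moment `∫_0^1 (-log v)^n v^{-w-1} · v·sin(2πt/v)/(πt) dv`. -/
noncomputable def logSinMoment (t : ℝ) (n : ℕ) (w : ℂ) : ℂ := mellin (truncLogSin t n) (-w)

theorem log_smul_truncLogSin (t : ℝ) (n : ℕ) (v : ℝ) :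
    Real.log v • truncLogSin t n v = -truncLogSin t (n + 1) v := by
  by_cases hv : v ∈ Ioo (0 : ℝ) 1
  · simp only [truncLogSin, indicator_of_mem hv, Complex.real_smul]
    push_cast
    ring
  · simp [truncLogSin, indicator_of_notMem hv]

theorem locallyIntegrableOn_truncLogSin (t : ℝ) (n : ℕ) :
    LocallyIntegrableOn (truncLogSin t n) (Ioi 0) := by
  have hc : ContinuousOn (fun v : ℝ =>
      (((-Real.log v) ^ n * (v * Real.sin (2 * Real.pi * t / v) / (Real.pi * t)) : ℝ) : ℂ))
      (Ioi 0) := by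
    refine Complex.continuous_ofReal.comp_continuousOn ?_
    refine ContinuousOn.mul ((Real.continuousOn_log.mono fun x hx => ne_of_gt hx).neg.pow n) ?_
    refine ContinuousOn.div_const (continuousOn_id.mul (Real.continuous_sin.comp_continuousOn ?_)) _
    exact continuousOn_const.div continuousOn_id fun x hx => ne_of_gt hx
  intro x hx
  obtain ⟨U, hU, hUi⟩ := hc.locallyIntegrableOn (μ := volume) measurableSet_Ioi x hx
  exact ⟨U, hU, hUi.indicator measurableSet_Ioo⟩

theorem truncLogSin_isBigO_atTop (t : ℝ) (n : ℕ) (a : ℝ) :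
    truncLogSin t n =O[atTop] (fun v : ℝ => v ^ (-a)) := by
  refine Asymptotics.IsBigO.of_bound 0 ?_
  filter_upwards [eventually_ge_atTop 1] with v hv
  have : v ∉ Ioo (0 : ℝ) 1 := fun h => not_lt.2 hv h.2
  simp [truncLogSin, indicator_of_notMem this]

open Topology in
theorem truncLogSin_isBigO_nhdsGT_zero (t : ℝ) (n : ℕ) {b : ℝ} (hb : -1 < b) :
    truncLogSin t n =O[𝓝[>] 0] (fun v : ℝ => v ^ (-b)) := by
  induction n generalizing b with
  | zero =>
    refine Asymptotics.IsBigO.of_bound ‖(Real.pi * t)⁻¹‖ ?_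
    filter_upwards [Ioo_mem_nhdsGT zero_lt_one] with v hv
    rw [truncLogSin, indicator_of_mem hv, Complex.norm_real, pow_zero, one_mul, div_eq_mul_inv,
      norm_mul, mul_comm, norm_mul, Real.norm_of_nonneg hv.1.le,
      Real.norm_of_nonneg (Real.rpow_nonneg hv.1.le _)]
    refine mul_le_mul_of_nonneg_left ?_ (norm_nonneg _)
    calc v * ‖Real.sin (2 * Real.pi * t / v)‖ ≤ v * 1 :=
          mul_le_mul_of_nonneg_left (Real.abs_sin_le_one _) hv.1.le
      _ = v ^ (1 : ℝ) := by simp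
      _ ≤ v ^ (-b) := Real.rpow_le_rpow_of_exponent_ge hv.1 hv.2.le (by linarith)
  | succ n ih =>
    obtain ⟨c, hc, hcb⟩ := exists_between hb
    have h := isBigO_rpow_zero_log_smul hcb (ih hc)
    simp only [log_smul_truncLogSin] at h
    simpa using h.neg_left

theorem mellinConvergent_truncLogSin (t : ℝ) (n : ℕ) {s : ℂ} (hs : -1 < s.re) :
    MellinConvergent (truncLogSin t n) s := by
  obtain ⟨c, hc, hcb⟩ := exists_between hs
  exact mellinConvergent_of_isBigO_rpow (locallyIntegrableOn_truncLogSin t n)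
    (truncLogSin_isBigO_atTop t n (s.re + 1)) (lt_add_one _)
    (truncLogSin_isBigO_nhdsGT_zero t n hc) hcb

theorem hasDerivAt_logSinMoment (t : ℝ) (n : ℕ) {w : ℂ} (hw : w.re < 1) :
    HasDerivAt (logSinMoment t n) (logSinMoment t (n + 1) w) w := by
  have hs : -1 < (-w).re := by simpa using hw
  obtain ⟨c, hc, hcb⟩ := exists_between hs
  have h := (mellin_hasDerivAt_of_isBigO_rpow (locallyIntegrableOn_truncLogSin t n)
    (truncLogSin_isBigO_atTop t n ((-w).re + 1)) (lt_add_one _)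
    (truncLogSin_isBigO_nhdsGT_zero t n hc) hcb).2
  simp only [log_smul_truncLogSin] at h
  have h2 := h.scomp w (hasDerivAt_neg w)
  refine h2.congr_deriv ?_
  simp [logSinMoment, mellin, MeasureTheory.integral_neg]

open Topology in
theorem tendsto_log_pow_mul_rpow_nhdsGT_zero {k : ℕ} (hk : 1 ≤ k) {r : ℝ} (hr : 0 < r) :
    Tendsto (fun x : ℝ => Real.log x ^ k * x ^ r) (𝓝[>] 0) (𝓝 0) := by
  have hk' : (0 : ℝ) < k := by exact_mod_cast hk
  have h := (tendsto_log_mul_rpow_nhdsGT_zero (div_pos hr hk')).pow k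
  rw [zero_pow (by omega)] at h
  refine h.congr' ?_
  filter_upwards [self_mem_nhdsWithin] with x hx
  rw [mul_pow, ← Real.rpow_mul_natCast (le_of_lt hx), div_mul_cancel₀ _ hk'.ne']

/-- Integration by parts: the conditionally convergent integral against `d[v·sin(2πt/v)/(πt)]` is a
combination of absolutely convergent moments. -/
theorem integral_log_pow_mul_cpow_mul_deriv {k : ℕ} (hk : 1 ≤ k) (w : ℂ) {t : ℝ} (ht : 0 < t)
    {δ : ℝ} (hδ : 0 < δ) (hδ1 : δ < 1) :
    ∫ v in δ..1, ((Real.log (1/v) : ℝ) : ℂ) ^ k * (v : ℂ) ^ (-w)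
      * ((deriv (fun x : ℝ => x * Real.sin (2 * Real.pi * t / x) / (Real.pi * t)) v : ℝ) : ℂ) =
    (∫ v in δ..1, (v : ℂ) ^ (-w - 1) • (k * truncLogSin t (k - 1) v + w * truncLogSin t k v)) -
      (Real.log (1/δ) : ℂ) ^ k * (δ : ℂ) ^ (-w) *
        ((δ * Real.sin (2 * Real.pi * t / δ) / (Real.pi * t) : ℝ) : ℂ) := by
  have hI : uIcc δ 1 = Icc δ 1 := uIcc_of_le hδ1.le
  have hpos : ∀ x ∈ uIcc δ 1, 0 < x := fun x hx => by rw [hI] at hx; exact hδ.trans_le hx.1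
  set g : ℝ → ℝ := fun x => x * Real.sin (2 * Real.pi * t / x) / (Real.pi * t) with hg
  set g' : ℝ → ℝ := fun x => (Real.sin (2 * Real.pi * t / x) -
    2 * Real.pi * t / x * Real.cos (2 * Real.pi * t / x)) / (Real.pi * t) with hg'
  have hgd : ∀ x, 0 < x → HasDerivAt g (g' x) x := by
    intro x hx
    have h1 : HasDerivAt (fun x : ℝ => 2 * Real.pi * t / x) (-(2 * Real.pi * t) / x ^ 2) x := by
      simpa using (hasDerivAt_const x (2 * Real.pi * t)).fun_div (hasDerivAt_id x) hx.ne'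
    have h2 := ((hasDerivAt_id x).fun_mul h1.sin).div_const (Real.pi * t)
    refine h2.congr_deriv ?_
    simp only [hg', id]
    field_simp
    ring
  set u : ℝ → ℂ := fun v => ((Real.log (1/v) : ℝ) : ℂ) ^ k * (v : ℂ) ^ (-w) with hu
  set u' : ℝ → ℂ := fun v => -((v : ℂ) ^ (-w - 1) *
    (k * ((-Real.log v : ℝ) : ℂ) ^ (k - 1) + w * ((-Real.log v : ℝ) : ℂ) ^ k)) with hu'
  have hud : ∀ x, 0 < x → HasDerivAt u (u' x) x := by
    intro x hx
    have hx0 : (x : ℂ) ≠ 0 := Complex.ofReal_ne_zero.2 hx.ne'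
    have h1 : HasDerivAt (fun v : ℝ => (v : ℂ) ^ (-w)) (-w * (x : ℂ) ^ (-w - 1)) x := by
      rcases eq_or_ne w 0 with rfl | hw
      · simpa using hasDerivAt_const x (1 : ℂ)
      · exact hasDerivAt_ofReal_cpow_const hx.ne' (neg_ne_zero.2 hw)
    have h2 : HasDerivAt (fun v : ℝ => ((-Real.log v : ℝ) : ℂ)) ((-x⁻¹ : ℝ) : ℂ) x :=
      (Real.hasDerivAt_log hx.ne').fun_neg.ofReal_comp
    have h3 := (h2.fun_pow k).fun_mul h1
    have e : u = fun v : ℝ => ((-Real.log v : ℝ) : ℂ) ^ k * (v : ℂ) ^ (-w) := by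
      funext v
      simp [hu, Real.log_inv]
    rw [e]
    refine h3.congr_deriv ?_
    have : (x : ℂ) ^ (-w) = x * (x : ℂ) ^ (-w - 1) := by
      rw [Complex.cpow_sub _ _ hx0, Complex.cpow_one]
      field_simp
    rw [this, hu']
    push_cast
    field_simp
    ring
  have hcpow : ContinuousOn (fun v : ℝ => (v : ℂ) ^ (-w - 1)) (uIcc δ 1) := fun x hx =>
    (Complex.continuousAt_ofReal_cpow_const _ _ (Or.inr (hpos x hx).ne')).continuousWithinAt
  have hlog : ContinuousOn (fun v : ℝ => ((-Real.log v : ℝ) : ℂ)) (uIcc δ 1) :=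
    Complex.continuous_ofReal.comp_continuousOn
      (Real.continuousOn_log.mono fun x hx => (hpos x hx).ne').neg
  have hu'c : ContinuousOn u' (uIcc δ 1) :=
    (hcpow.mul ((continuousOn_const.mul (hlog.pow _)).add (continuousOn_const.mul (hlog.pow _)))).neg
  have hdiv : ContinuousOn (fun x : ℝ => 2 * Real.pi * t / x) (uIcc δ 1) :=
    continuousOn_const.div continuousOn_id fun x hx => (hpos x hx).ne'
  have hg'c : ContinuousOn (fun v => ((g' v : ℝ) : ℂ)) (uIcc δ 1) := by
    refine Complex.continuous_ofReal.comp_continuousOn (ContinuousOn.div_const ?_ _)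
    exact (Real.continuous_sin.comp_continuousOn hdiv).sub
      (hdiv.mul (Real.continuous_cos.comp_continuousOn hdiv))
  have hparts := integral_mul_deriv_eq_deriv_mul_of_hasDerivWithinAt (u := u) (u' := u')
    (v := fun v => ((g v : ℝ) : ℂ)) (v' := fun v => ((g' v : ℝ) : ℂ)) (a := δ) (b := 1)
    (fun x hx => (hud x (hpos x hx)).hasDerivWithinAt)
    (fun x hx => (hgd x (hpos x hx)).ofReal_comp.hasDerivWithinAt)
    hu'c.intervalIntegrable hg'c.intervalIntegrable
  have hu1 : u 1 = 0 := by
    simp [hu]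
    omega
  have e1 : ∫ v in δ..1, u v * ((deriv g v : ℝ) : ℂ) = ∫ v in δ..1, u v * ((g' v : ℝ) : ℂ) :=
    intervalIntegral.integral_congr fun x hx => by
      simp only [(hgd x (hpos x hx)).deriv]
  have e2 : ∫ v in δ..1, u' v * ((g v : ℝ) : ℂ) = -∫ v in δ..1, (v : ℂ) ^ (-w - 1) •
      (k * truncLogSin t (k - 1) v + w * truncLogSin t k v) := by
    rw [← intervalIntegral.integral_neg]
    refine intervalIntegral.integral_congr_ae ?_
    have h1 : ∀ᵐ v : ℝ, v ≠ 1 := by simp [ae_iff]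
    filter_upwards [h1] with v hv1 hv
    rw [uIoc_of_le hδ1.le] at hv
    have hm : v ∈ Ioo (0 : ℝ) 1 := ⟨hδ.trans hv.1, lt_of_le_of_ne hv.2 hv1⟩
    simp only [truncLogSin, indicator_of_mem hm, hu', hg, smul_eq_mul]
    push_cast
    ring
  rw [e1, hparts, e2, hu1]
  ring

open Topology in
theorem tendsto_integral_log_pow_mul_cpow_mul_deriv {k : ℕ} (hk : 1 ≤ k) {w : ℂ} (hw : w.re < 1)
    {t : ℝ} (ht : 0 < t) :
    Tendsto (fun δ : ℝ => ∫ v in δ..1, ((Real.log (1/v) : ℝ) : ℂ) ^ k * (v : ℂ) ^ (-w)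
      * ((deriv (fun x : ℝ => x * Real.sin (2 * Real.pi * t / x) / (Real.pi * t)) v : ℝ) : ℂ))
      (𝓝[>] 0) (𝓝 (k * logSinMoment t (k - 1) w + w * logSinMoment t k w)) := by
  have hs : -1 < (-w).re := by simpa using hw
  set P : ℝ → ℂ := fun v => (v : ℂ) ^ (-w - 1) •
    (k * truncLogSin t (k - 1) v + w * truncLogSin t k v) with hP
  have c1 := mellinConvergent_truncLogSin t (k - 1) hs
  have c2 := mellinConvergent_truncLogSin t k hs
  have hM := hasMellin_add (c1.const_smul (k : ℂ)) (c2.const_smul w)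
  have hPi : IntegrableOn P (Ioi 0) := hM.1
  have hPe : ∫ v in Ioi 0, P v = k * logSinMoment t (k - 1) w + w * logSinMoment t k w := by
    rw [logSinMoment, logSinMoment, ← smul_eq_mul, ← smul_eq_mul, ← mellin_const_smul,
      ← mellin_const_smul, ← hM.2]
    rfl
  have hP01 : ∫ v in (0 : ℝ)..1, P v = ∫ v in Ioi 0, P v := by
    rw [intervalIntegral.integral_of_le zero_le_one]
    symm
    refine setIntegral_eq_of_subset_of_forall_sdiff_eq_zero measurableSet_Ioi Ioc_subset_Ioi_self ?_
    rintro x ⟨hx0, hx⟩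
    have : x ∉ Ioo (0 : ℝ) 1 := fun h => hx ⟨h.1, h.2.le⟩
    simp [hP, truncLogSin, indicator_of_notMem this]
  have hlim1 : Tendsto (fun δ : ℝ => ∫ v in δ..1, P v) (𝓝[>] 0) (𝓝 (∫ v in (0 : ℝ)..1, P v)) := by
    have hint : IntegrableOn P (uIcc 0 1) := by
      rw [uIcc_of_le zero_le_one, integrableOn_Icc_iff_integrableOn_Ioc]
      exact hPi.mono_set Ioc_subset_Ioi_self
    have h := intervalIntegral.continuousOn_primitive_interval_left hint 0 left_mem_uIcc
    rw [uIcc_of_le zero_le_one] at h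
    exact h.tendsto.mono_left (nhdsWithin_le_of_mem (Icc_mem_nhdsGT zero_lt_one))
  have hlim2 : Tendsto (fun δ : ℝ => (Real.log (1/δ) : ℂ) ^ k * (δ : ℂ) ^ (-w) *
        ((δ * Real.sin (2 * Real.pi * t / δ) / (Real.pi * t) : ℝ) : ℂ)) (𝓝[>] 0) (𝓝 0) := by
    have h := ((tendsto_log_pow_mul_rpow_nhdsGT_zero hk
      (by linarith : 0 < 1 - w.re)).norm.div_const (Real.pi * t))
    rw [norm_zero, zero_div] at h
    refine squeeze_zero_norm' ?_ h
    filter_upwards [self_mem_nhdsWithin] with δ hδ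
    have hδ' : (0 : ℝ) < δ := hδ
    rw [norm_mul, norm_mul, norm_pow, Complex.norm_real, Complex.norm_real,
      Complex.norm_cpow_eq_rpow_re_of_pos hδ', one_div, Real.log_inv, norm_neg, norm_div, norm_mul,
      Real.norm_of_nonneg (by positivity : 0 ≤ Real.pi * t), norm_mul, norm_pow,
      Real.norm_of_nonneg hδ'.le, Real.norm_of_nonneg (Real.rpow_nonneg hδ'.le _), Complex.neg_re,
      sub_eq_add_neg, Real.rpow_add hδ', Real.rpow_one, mul_div_assoc']
    refine div_le_div_of_nonneg_right ?_ (by positivity)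
    rw [mul_assoc, mul_comm δ (δ ^ _)]
    refine mul_le_mul_of_nonneg_left (mul_le_mul_of_nonneg_left ?_ (by positivity)) (by positivity)
    exact mul_le_of_le_one_right hδ'.le (Real.abs_sin_le_one _)
  have := hlim1.sub hlim2
  rw [sub_zero, hP01, hPe] at this
  refine this.congr' ?_
  filter_upwards [Ioo_mem_nhdsGT zero_lt_one] with δ hδ
  exact (integral_log_pow_mul_cpow_mul_deriv hk w ht hδ.1 hδ.2).symm

/-- The coefficient of `u^{2(j+1)}` in the power series of `sin(2πtu)/(2πtu)`. -/
noncomputable def sincCoeff (t : ℝ) (j : ℕ) : ℂ :=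
  (-1 : ℂ) ^ (j+1) * (((2 * Real.pi * t) ^ (2*(j+1)) : ℝ) : ℂ)
    / ((Nat.factorial (2*(j+1)+1) : ℕ) : ℂ)

/-- The series `Σ_{n ≥ 1} (-1)^n (2πt)^{2n}/(2n+1)! · 2n/(w+2n)^{m+1}`, indexed by `n = j + 1`. -/
noncomputable def sincPoleSeries (t : ℝ) (m : ℕ) (w : ℂ) : ℂ :=
  ∑' j : ℕ, sincCoeff t j * ((2*(j+1) : ℕ) : ℂ) / (w + ((2*(j+1) : ℕ) : ℂ)) ^ (m+1)

theorem norm_sincCoeff_mul_le {t : ℝ} (ht : 0 ≤ t) (j : ℕ) :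
    ‖sincCoeff t j * ((2*(j+1) : ℕ) : ℂ)‖ ≤
      (2 * Real.pi * t) ^ (2*(j+1)) / (Nat.factorial (2*(j+1)) : ℝ) := by
  have hX : 0 ≤ 2 * Real.pi * t := by positivity
  have hf : (0 : ℝ) < (Nat.factorial (2*(j+1)) : ℝ) := by positivity
  rw [sincCoeff, norm_mul, norm_div, norm_mul, norm_pow, norm_neg, norm_one, one_pow, one_mul,
    Complex.norm_real, Complex.norm_natCast, Complex.norm_natCast,
    Real.norm_of_nonneg (pow_nonneg hX _), Nat.factorial_succ, div_mul_eq_mul_div,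
    div_le_div_iff₀ (by positivity) hf, mul_assoc]
  refine mul_le_mul_of_nonneg_left ?_ (pow_nonneg hX _)
  push_cast
  exact mul_le_mul_of_nonneg_right (by linarith) hf.le

theorem summable_pow_div_factorial_even (x : ℝ) :
    Summable fun j : ℕ => x ^ (2*(j+1)) / (Nat.factorial (2*(j+1)) : ℝ) :=
  (Real.summable_pow_div_factorial x).comp_injective
    (i := fun j : ℕ => 2 * (j + 1)) fun a b h => by simpa using h

theorem one_le_norm_add_natCast {w : ℂ} (hw : 0 < w.re) (j : ℕ) :
    1 ≤ ‖w + ((2*(j+1) : ℕ) : ℂ)‖ := by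
  refine le_trans ?_ (Complex.re_le_norm _)
  rw [Complex.add_re, Complex.natCast_re]
  push_cast
  linarith [(Nat.cast_nonneg j : (0 : ℝ) ≤ j)]

theorem norm_sincPoleSeries_term_le {t : ℝ} (ht : 0 ≤ t) (m : ℕ) {w : ℂ} (hw : 0 < w.re) (j : ℕ) :
    ‖sincCoeff t j * ((2*(j+1) : ℕ) : ℂ) / (w + ((2*(j+1) : ℕ) : ℂ)) ^ (m+1)‖ ≤
      (2 * Real.pi * t) ^ (2*(j+1)) / (Nat.factorial (2*(j+1)) : ℝ) := by
  rw [norm_div, norm_pow]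
  exact (div_le_self (norm_nonneg _) (one_le_pow₀ (one_le_norm_add_natCast hw j))).trans
    (norm_sincCoeff_mul_le ht j)

theorem summable_norm_sincPoleSeries_term {t : ℝ} (ht : 0 ≤ t) (m : ℕ) {w : ℂ} (hw : 0 < w.re) :
    Summable fun j : ℕ =>
      ‖sincCoeff t j * ((2*(j+1) : ℕ) : ℂ) / (w + ((2*(j+1) : ℕ) : ℂ)) ^ (m+1)‖ :=
  (summable_pow_div_factorial_even _).of_nonneg_of_le (fun _ => norm_nonneg _)
    (norm_sincPoleSeries_term_le ht m hw)

theorem norm_sincPoleSeries_le {t : ℝ} (ht : 0 ≤ t) (ht1 : t ≤ 1) (m : ℕ) {w : ℂ}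
    (hw : 0 < w.re) :
    ‖sincPoleSeries t m w‖ ≤
      ∑' j : ℕ, (2 * Real.pi) ^ (2*(j+1)) / (Nat.factorial (2*(j+1)) : ℝ) := by
  refine tsum_of_norm_bounded (summable_pow_div_factorial_even _).hasSum fun j =>
    (norm_sincPoleSeries_term_le ht m hw j).trans ?_
  have : 2 * Real.pi * t ≤ 2 * Real.pi := mul_le_of_le_one_right (by positivity) ht1
  gcongr

theorem hasDerivAt_sincPoleSeries {t : ℝ} (ht : 0 ≤ t) (m : ℕ) {w : ℂ} (hw : 0 < w.re) :
    HasDerivAt (sincPoleSeries t m) (-(m + 1) * sincPoleSeries t (m + 1) w) w := by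
  have hne : ∀ (j : ℕ) (y : ℂ), 0 < y.re → y + ((2*(j+1) : ℕ) : ℂ) ≠ 0 := fun j y hy h => by
    have := one_le_norm_add_natCast hy j
    rw [h, norm_zero] at this
    linarith
  have h := hasDerivAt_tsum_of_isPreconnected (𝕜 := ℂ) (t := {z : ℂ | 0 < z.re}) (y := w) (y₀ := w)
    (g := fun (j : ℕ) (z : ℂ) =>
      sincCoeff t j * ((2*(j+1) : ℕ) : ℂ) / (z + ((2*(j+1) : ℕ) : ℂ)) ^ (m+1))
    (g' := fun (j : ℕ) (z : ℂ) => -(m + 1) *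
      (sincCoeff t j * ((2*(j+1) : ℕ) : ℂ) / (z + ((2*(j+1) : ℕ) : ℂ)) ^ (m+1+1)))
    ((summable_pow_div_factorial_even (2 * Real.pi * t)).mul_left (m + 1 : ℝ))
    (isOpen_lt continuous_const Complex.continuous_re) (convex_halfSpace_re_gt 0).isPreconnected
    (fun j y hy => ?_) (fun j y hy => ?_) hw (summable_norm_sincPoleSeries_term ht m hw).of_norm hw
  · rw [tsum_mul_left] at h
    exact h
  · have hy0 := hne j y hy
    have h1 := (((hasDerivAt_id y).add_const ((2*(j+1) : ℕ) : ℂ)).fun_pow (m + 1)).fun_inv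
      (pow_ne_zero _ hy0)
    have h2 := h1.const_mul (sincCoeff t j * ((2*(j+1) : ℕ) : ℂ))
    simp only [← div_eq_mul_inv] at h2
    refine h2.congr_deriv ?_
    simp only [id, Nat.add_sub_cancel]
    field_simp
    push_cast
    ring
  · rw [norm_mul, norm_neg]
    refine mul_le_mul (le_of_eq ?_) (norm_sincPoleSeries_term_le ht (m + 1) hy j) (norm_nonneg _)
      (by positivity)
    exact_mod_cast Complex.norm_natCast (m + 1)

theorem summable_sincCoeff {t : ℝ} (ht : 0 ≤ t) : Summable (sincCoeff t) := by
  refine Summable.of_norm_bounded (summable_pow_div_factorial_even (2 * Real.pi * t)) fun j =>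
    le_trans ?_ (norm_sincCoeff_mul_le ht j)
  rw [norm_mul, Complex.norm_natCast]
  refine le_mul_of_one_le_right (norm_nonneg _) ?_
  exact_mod_cast (by omega : 1 ≤ 2 * (j + 1))

theorem mul_mellin_indicator_sin_div {t : ℝ} (ht : 0 < t) {w : ℂ} (h0 : 0 < w.re) :
    w * mellin (indicator (Ioc 0 1) fun u : ℝ =>
        ((Real.sin (2 * Real.pi * t * u) / (Real.pi * t * u) : ℝ) : ℂ)) w =
      2 + 2 * ∑' j, sincCoeff t j - 2 * sincPoleSeries t 0 w := by
  have hw : w ≠ 0 := fun h => by simp [h] at h0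
  have h := hasSum_mellin_indicator_sin_div ht h0
  rw [← h.tsum_eq, h.summable.tsum_eq_zero_add, mul_add, ← tsum_mul_left, add_sub_assoc,
    ← mul_sub, sincPoleSeries, ← (summable_sincCoeff ht.le).tsum_sub
      (summable_norm_sincPoleSeries_term ht.le 0 h0).of_norm, ← tsum_mul_left]
  congr 1
  · simp
    field_simp
  · refine tsum_congr fun j => ?_
    have hne : w + ((2*(j+1) : ℕ) : ℂ) ≠ 0 := fun h => by
      have := one_le_norm_add_natCast h0 j
      rw [h, norm_zero] at this
      linarith
    rw [← sincCoeff, zero_add, pow_one]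
    field_simp
    ring

theorem mul_logSinMoment_zero {t : ℝ} (ht : 0 < t) {w : ℂ} (h0 : 0 < w.re) (h1 : w.re < 1) :
    w * logSinMoment t 0 w = baezDuarteU w * (t : ℂ) ^ (-w) - (2 + 2 * ∑' j, sincCoeff t j) +
      2 * sincPoleSeries t 0 w := by
  set f : ℝ → ℂ := fun u => ((Real.sin (2 * Real.pi * t * u) / (Real.pi * t * u) : ℝ) : ℂ) with hf
  have hM := hasMellin_sin_div ht h0 h1
  have hInd : MellinConvergent (indicator (Ioc 0 1) f) w := by
    have := hM.1.indicator (measurableSet_Ioc (a := (0 : ℝ)) (b := 1))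
    rwa [indicator_smul] at this
  have hsub := hasMellin_sub hM.1 hInd
  have e : logSinMoment t 0 w = mellin (fun u => f u - indicator (Ioc 0 1) f u) w := by
    rw [logSinMoment, ← mellin_comp_inv]
    refine setIntegral_congr_fun measurableSet_Ioi fun u hu => ?_
    have hu0 : (0 : ℝ) < u := hu
    simp only
    congr 1
    rcases le_or_gt u 1 with h | h
    · have h1 : u⁻¹ ∉ Ioo (0 : ℝ) 1 := fun h' => not_lt.2 ((one_le_inv₀ hu0).2 h) h'.2
      rw [truncLogSin, indicator_of_notMem h1, indicator_of_mem (show u ∈ Ioc (0 : ℝ) 1 from ⟨hu0, h⟩),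
        sub_self]
    · have h1 : u⁻¹ ∈ Ioo (0 : ℝ) 1 := ⟨inv_pos.2 hu0, inv_lt_one_of_one_lt₀ h⟩
      have h2 : u ∉ Ioc (0 : ℝ) 1 := fun h' => not_le.2 h h'.2
      rw [truncLogSin, indicator_of_mem h1, indicator_of_notMem h2, sub_zero, hf]
      simp only [pow_zero, one_mul, div_inv_eq_mul]
      congr 1
      field_simp
  rw [e, hsub.2, mul_sub, hM.2, mul_mellin_indicator_sin_div ht h0, baezDuarteU_mul_cpow_eq ht h1]
  ring

theorem iteratedDeriv_baezDuarteU_mul_cpow {t : ℝ} (ht : 0 < t) {k : ℕ} (hk : 1 ≤ k) {w : ℂ}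
    (h0 : 0 < w.re) (h1 : w.re < 1) :
    iteratedDeriv k (fun z : ℂ => baezDuarteU z * (t : ℂ) ^ (-z)) w =
      k * logSinMoment t (k - 1) w + w * logSinMoment t k w -
        2 * (-1 : ℂ) ^ k * (Nat.factorial k : ℂ) * sincPoleSeries t k w := by
  set S : Set ℂ := {z | 0 < z.re} ∩ {z | z.re < 1} with hS
  have hSo : IsOpen S := (isOpen_lt continuous_const Complex.continuous_re).inter
    (isOpen_lt Complex.continuous_re continuous_const)
  set F : ℕ → ℂ → ℂ := fun n z => n * logSinMoment t (n - 1) z + z * logSinMoment t n z +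
    (if n = 0 then 2 + 2 * ∑' j, sincCoeff t j else 0) -
    2 * (-1 : ℂ) ^ n * (Nat.factorial n : ℂ) * sincPoleSeries t n z with hF
  have hder : ∀ n, ∀ z ∈ S, HasDerivAt (F n) (F (n + 1) z) z := by
    rintro n z ⟨hz0, hz1⟩
    have d1 : HasDerivAt (fun z => (n : ℂ) * logSinMoment t (n - 1) z)
        (n * logSinMoment t n z) z := by
      rcases n with _ | n
      · simpa using hasDerivAt_const z (0 : ℂ)
      · exact (hasDerivAt_logSinMoment t n hz1).const_mul _
    have d := ((d1.fun_add ((hasDerivAt_id z).fun_mul (hasDerivAt_logSinMoment t n hz1))).add_const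
      (if n = 0 then 2 + 2 * ∑' j, sincCoeff t j else 0)).fun_sub
      ((hasDerivAt_sincPoleSeries ht.le n hz0).const_mul (2 * (-1 : ℂ) ^ n * (Nat.factorial n : ℂ)))
    refine d.congr_deriv ?_
    simp only [hF, id, Nat.add_sub_cancel, if_neg n.succ_ne_zero, Nat.factorial_succ]
    push_cast
    ring
  have hEq : (fun z : ℂ => baezDuarteU z * (t : ℂ) ^ (-z)) =ᶠ[nhds w] F 0 := by
    filter_upwards [hSo.mem_nhds ⟨h0, h1⟩] with z hz
    simp only [hF, mul_logSinMoment_zero ht hz.1 hz.2, Nat.cast_zero, zero_mul, zero_add, if_true,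
      pow_zero, mul_one, Nat.factorial_zero, Nat.cast_one]
    ring
  rw [hEq.iteratedDeriv_eq, iteratedDeriv_eq_of_hasDerivAt_succ hSo F hder k w ⟨h0, h1⟩]
  simp only [hF, if_neg (by omega : k ≠ 0), add_zero]

/-- For `k ≥ 1`, `0 < Re w < 1` and `t > 0`,
`φ_{w,k}(t) = (d/dw)^k[U(w)·t^{-w}] + 2(-1)^k k! Σ_{j≥1} (-1)^j (2πt)^{2j}/(2j+1)! · 2j/(w+2j)^{k+1}`
with the series absolutely convergent; consequently
`φ_{w,k}(t) = (d/dw)^k[U(w)·t^{-w}] + O(1)` on `0 < t ≤ 1`, uniformly for `0 < Re w < 1`. -/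
theorem phi_k_eq_iteratedDeriv_add_series (k : ℕ) (hk : 1 ≤ k) :
    ∃ φ : ℂ → ℝ → ℂ,
      (∀ w : ℂ, w.re < 1 → ∀ t : ℝ, 0 < t →
        Filter.Tendsto
          (fun δ : ℝ => ∫ v in δ..1,
            ((Real.log (1/v) : ℝ) : ℂ) ^ k * (v : ℂ) ^ (-w)
              * ((deriv (fun x : ℝ =>
                  x * Real.sin (2 * Real.pi * t / x) / (Real.pi * t)) v : ℝ) : ℂ))
          (nhdsWithin 0 (Set.Ioi 0)) (nhds (φ w t))) ∧
      (∀ w : ℂ, 0 < w.re → w.re < 1 → ∀ t : ℝ, 0 < t →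
        Summable (fun j : ℕ =>
          ‖(-1 : ℂ) ^ (j+1) * (((2 * Real.pi * t) ^ (2*(j+1)) : ℝ) : ℂ)
              / ((Nat.factorial (2*(j+1)+1) : ℕ) : ℂ) * ((2*(j+1) : ℕ) : ℂ)
              / (w + ((2*(j+1) : ℕ) : ℂ)) ^ (k+1)‖) ∧
        φ w t = iteratedDeriv k (fun z : ℂ => baezDuarteU z * (t : ℂ) ^ (-z)) w
          + 2 * (-1 : ℂ) ^ k * ((Nat.factorial k : ℕ) : ℂ)
            * ∑' j : ℕ,
                (-1 : ℂ) ^ (j+1) * (((2 * Real.pi * t) ^ (2*(j+1)) : ℝ) : ℂ)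
                  / ((Nat.factorial (2*(j+1)+1) : ℕ) : ℂ) * ((2*(j+1) : ℕ) : ℂ)
                  / (w + ((2*(j+1) : ℕ) : ℂ)) ^ (k+1)) ∧
      (∃ C : ℝ, ∀ w : ℂ, 0 < w.re → w.re < 1 → ∀ t : ℝ, 0 < t → t ≤ 1 →
        ‖φ w t - iteratedDeriv k (fun z : ℂ => baezDuarteU z * (t : ℂ) ^ (-z)) w‖ ≤ C) := by
  refine ⟨fun w t => k * logSinMoment t (k - 1) w + w * logSinMoment t k w,
    fun w hw t ht => tendsto_integral_log_pow_mul_cpow_mul_deriv hk hw ht,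
    fun w h0 h1 t ht => ⟨summable_norm_sincPoleSeries_term ht.le k h0, ?_⟩,
    2 * (Nat.factorial k : ℝ) *
      ∑' j : ℕ, (2 * Real.pi) ^ (2*(j+1)) / (Nat.factorial (2*(j+1)) : ℝ), ?_⟩
  · rw [iteratedDeriv_baezDuarteU_mul_cpow ht hk h0 h1]
    exact (sub_add_cancel _ _).symm
  · intro w h0 h1 t ht ht1
    rw [iteratedDeriv_baezDuarteU_mul_cpow ht hk h0 h1, sub_sub_cancel, norm_mul, norm_mul,
      norm_mul, norm_pow, norm_neg, norm_one, one_pow, mul_one, Complex.norm_ofNat,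
      Complex.norm_natCast]
    exact mul_le_mul_of_nonneg_left (norm_sincPoleSeries_le ht.le ht1 k h0) (by positivity)
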